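/- Let 1 ≤ p₁ ≤ p₂ ≤ 2. Then there exist constants c₂ ≥ c₁ > 0, depending only on p₁ and p₂, such that for every N ∈ ℕ and every k ∈ ℕ with 4k ≤ N one has c₁ ≤ d_k(id : ℓ_{p₁}^N → ℓ_{p₂}^N) ≤ c₂. -/

import Mathlib

open scoped ENNReal

/-- The `k`-th Kolmogorov number of a continuous linear operator `T : X → Y`:
the infimum over subspaces `L ⊆ Y` with `dim L < k` of
`sup_{‖x‖ ≤ 1} inf_{z ∈ L} ‖T x - z‖`. -/
noncomputable def kolmogorovNumber {X Y : Type*} [NormedAddCommGroup X] [NormedSpace ℂ X]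
    [NormedAddCommGroup Y] [NormedSpace ℂ Y] (T : X →L[ℂ] Y) (k : ℕ) : ℝ :=
  sInf { r | ∃ L : Submodule ℂ Y, Module.rank ℂ L < (k : Cardinal) ∧
    r = ⨆ x : {x : X // ‖x‖ ≤ 1}, ⨅ z : L, ‖T x.1 - (z : Y)‖ }

/-- The identity operator `id : ℓ_{p₁}^N → ℓ_{p₂}^N` on `ℂ^N`. -/
noncomputable def lpId (p₁ p₂ : ℝ≥0∞) [Fact (1 ≤ p₁)] [Fact (1 ≤ p₂)] (N : ℕ) :
    PiLp p₁ (fun _ : Fin N => ℂ) →L[ℂ] PiLp p₂ (fun _ : Fin N => ℂ) :=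
  LinearMap.toContinuousLinearMap
    (((WithLp.linearEquiv p₂ ℂ (Fin N → ℂ)).symm.toLinearMap).comp
      (WithLp.linearEquiv p₁ ℂ (Fin N → ℂ)).toLinearMap)

theorem PiLp.norm_toLp_le_of_exponent_le {ι E : Type*} [Fintype ι] [NormedAddCommGroup E]
    {p q : ℝ≥0∞} [Fact (1 ≤ p)] [Fact (1 ≤ q)] (hpq : p ≤ q) (hq : q ≠ ∞) (x : ι → E) :
    ‖(WithLp.toLp q x : PiLp q fun _ : ι => E)‖ ≤ ‖(WithLp.toLp p x : PiLp p fun _ : ι => E)‖ := by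
  have hp : p ≠ ∞ := ne_top_of_le_ne_top hq hpq
  have hp0 : 0 < p.toReal := ENNReal.toReal_pos (zero_lt_one.trans_le Fact.out).ne' hp
  have hpq' : p.toReal ≤ q.toReal := ENNReal.toReal_mono hq hpq
  have hq0 : 0 < q.toReal := hp0.trans_le hpq'
  set A := ‖(WithLp.toLp p x : PiLp p fun _ : ι => E)‖ with hA
  have hA0 : 0 ≤ A := norm_nonneg _
  have hsum : ∑ i, ‖x i‖ ^ p.toReal = A ^ p.toReal := by
    rw [hA, PiLp.norm_eq_sum hp0, ← Real.rpow_mul (by positivity), one_div,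
      inv_mul_cancel₀ hp0.ne', Real.rpow_one]
  rw [PiLp.norm_eq_sum hq0, one_div, Real.rpow_inv_le_iff_of_pos (by positivity) hA0 hq0]
  calc ∑ i, ‖x i‖ ^ q.toReal
      ≤ ∑ i, ‖x i‖ ^ p.toReal * A ^ (q.toReal - p.toReal) := by
        refine Finset.sum_le_sum fun i _ => ?_
        have hi : ‖x i‖ ≤ A := PiLp.norm_apply_le (WithLp.toLp p x : PiLp p fun _ : ι => E) i
        calc ‖x i‖ ^ q.toReal = ‖x i‖ ^ p.toReal * ‖x i‖ ^ (q.toReal - p.toReal) := by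
              rw [← Real.rpow_add_of_nonneg (norm_nonneg _) hp0.le (by linarith),
                add_sub_cancel]
          _ ≤ _ := by
              gcongr
    _ = A ^ q.toReal := by
        rw [← Finset.sum_mul, hsum, ← Real.rpow_add_of_nonneg hA0 hp0.le (by linarith),
          add_sub_cancel]

theorem OrthonormalBasis.sum_sq_norm_starProjection {𝕜 E ι : Type*} [RCLike 𝕜] [Fintype ι]
    [NormedAddCommGroup E] [InnerProductSpace 𝕜 E] [FiniteDimensional 𝕜 E]
    (b : OrthonormalBasis ι 𝕜 E) (K : Submodule 𝕜 E) :
    ∑ i, ‖K.starProjection (b i)‖ ^ 2 = Module.finrank 𝕜 K := by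
  have hproj : LinearMap.IsProj K (K.starProjection : E →ₗ[𝕜] E) :=
    ⟨fun x => K.starProjection_apply_mem x,
      fun x hx => Submodule.starProjection_eq_self_iff.mpr hx⟩
  have htr := congrArg RCLike.re (hproj.trace.symm.trans (LinearMap.trace_eq_sum_inner _ b))
  rw [RCLike.natCast_re, map_sum] at htr
  rw [htr]
  refine Finset.sum_congr rfl fun i _ => ?_
  rw [ContinuousLinearMap.coe_coe, inner_re_symm, K.re_inner_starProjection_eq_normSq,
    Submodule.starProjection_apply, Submodule.coe_norm]

/-- Some vector of an orthonormal basis is far from any subspace of small dimension. -/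
theorem OrthonormalBasis.exists_half_le_norm_sub {𝕜 E ι : Type*} [RCLike 𝕜] [Fintype ι]
    [NormedAddCommGroup E] [InnerProductSpace 𝕜 E] [FiniteDimensional 𝕜 E]
    (b : OrthonormalBasis ι 𝕜 E) (K : Submodule 𝕜 E)
    (hK : 4 * Module.finrank 𝕜 K < Fintype.card ι) :
    ∃ i, ∀ z ∈ K, 1 / 2 ≤ ‖b i - z‖ := by
  obtain ⟨i, hi⟩ : ∃ i, ‖K.starProjection (b i)‖ ^ 2 < 1 / 4 := by
    by_contra! h
    have hsum := Finset.sum_le_sum fun i (_ : i ∈ Finset.univ) => h i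
    rw [b.sum_sq_norm_starProjection K, Finset.sum_const, Finset.card_univ, nsmul_eq_mul] at hsum
    have hK' : (4 : ℝ) * Module.finrank 𝕜 K < Fintype.card ι := by exact_mod_cast hK
    linarith
  refine ⟨i, fun z hz => ?_⟩
  have hlt : ‖K.starProjection (b i)‖ < 1 / 2 := by
    nlinarith [norm_nonneg (K.starProjection (b i))]
  calc (1 / 2 : ℝ) ≤ ‖b i‖ - ‖K.starProjection (b i)‖ := by rw [b.norm_eq_one]; linarith
    _ ≤ ‖b i - K.starProjection (b i)‖ := norm_sub_norm_le _ _
    _ = ⨅ x : K, ‖b i - x‖ := Submodule.starProjection_minimal _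
    _ ≤ ‖b i - z‖ := ciInf_le (f := fun x : K => ‖b i - x‖)
        ⟨0, by rintro _ ⟨x, rfl⟩; exact norm_nonneg _⟩ ⟨z, hz⟩

theorem bddBelow_range_norm_sub {Y : Type*} [NormedAddCommGroup Y] [NormedSpace ℂ Y]
    (L : Submodule ℂ Y) (y : Y) : BddBelow (Set.range fun z : L => ‖y - (z : Y)‖) :=
  ⟨0, by rintro _ ⟨z, rfl⟩; exact norm_nonneg _⟩

theorem iInf_norm_sub_le_norm {Y : Type*} [NormedAddCommGroup Y] [NormedSpace ℂ Y]
    (L : Submodule ℂ Y) (y : Y) : ⨅ z : L, ‖y - (z : Y)‖ ≤ ‖y‖ := by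
  simpa using ciInf_le (bddBelow_range_norm_sub L y) 0

theorem kolmogorovNumber_le_of_norm_le {X Y : Type*} [NormedAddCommGroup X] [NormedSpace ℂ X]
    [NormedAddCommGroup Y] [NormedSpace ℂ Y] (T : X →L[ℂ] Y) {C : ℝ}
    (hT : ∀ x, ‖x‖ ≤ 1 → ‖T x‖ ≤ C) {k : ℕ} (hk : 1 ≤ k) : kolmogorovNumber T k ≤ C := by
  have : Nonempty {x : X // ‖x‖ ≤ 1} := ⟨⟨0, by simp⟩⟩
  have hbdd : BddBelow { r | ∃ L : Submodule ℂ Y, Module.rank ℂ L < (k : Cardinal) ∧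
      r = ⨆ x : {x : X // ‖x‖ ≤ 1}, ⨅ z : L, ‖T x.1 - (z : Y)‖ } := by
    refine ⟨0, ?_⟩
    rintro _ ⟨L, -, rfl⟩
    exact Real.iSup_nonneg fun x => Real.iInf_nonneg fun z => norm_nonneg _
  have hbot : Module.rank ℂ (⊥ : Submodule ℂ Y) < (k : Cardinal) := by
    rw [rank_bot]
    exact_mod_cast hk
  exact (csInf_le hbdd ⟨⊥, hbot, rfl⟩).trans
    (ciSup_le fun x => (iInf_norm_sub_le_norm ⊥ _).trans (hT x.1 x.2))

theorem le_kolmogorovNumber {X Y : Type*} [NormedAddCommGroup X] [NormedSpace ℂ X]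
    [NormedAddCommGroup Y] [NormedSpace ℂ Y] (T : X →L[ℂ] Y) {c : ℝ} {k : ℕ} (hk : 1 ≤ k)
    (h : ∀ L : Submodule ℂ Y, Module.rank ℂ L < (k : Cardinal) →
      ∃ x, ‖x‖ ≤ 1 ∧ ∀ z ∈ L, c ≤ ‖T x - z‖) : c ≤ kolmogorovNumber T k := by
  refine le_csInf ⟨_, ⊥, ?_, rfl⟩ ?_
  · rw [rank_bot]
    exact_mod_cast hk
  · rintro _ ⟨L, hL, rfl⟩
    obtain ⟨x, hx, hxL⟩ := h L hL
    have hbdd : BddAbove (Set.range fun x : {x : X // ‖x‖ ≤ 1} =>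
        ⨅ z : L, ‖T x.1 - (z : Y)‖) := by
      refine ⟨‖T‖, ?_⟩
      rintro _ ⟨y, rfl⟩
      exact (iInf_norm_sub_le_norm L _).trans (T.unit_le_opNorm _ y.2)
    exact (le_ciInf fun z : L => hxL z z.2).trans (le_ciSup hbdd ⟨x, hx⟩)

/-- If `1 ≤ p₁ ≤ p₂ ≤ 2`, then `d_k(id : ℓ_{p₁}^N → ℓ_{p₂}^N) ∼ 1` for `4k ≤ N`,
with equivalence constants depending only on `p₁, p₂`. -/
theorem stmt4 (p₁ p₂ : ℝ≥0∞) [Fact (1 ≤ p₁)] [Fact (1 ≤ p₂)]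
    (h₁ : p₁ ≤ p₂) (h₂ : p₂ ≤ 2) :
    ∃ c₁ c₂ : ℝ, 0 < c₁ ∧ c₁ ≤ c₂ ∧
      ∀ N k : ℕ, 1 ≤ k → 4 * k ≤ N →
        c₁ ≤ kolmogorovNumber (lpId p₁ p₂ N) k ∧ kolmogorovNumber (lpId p₁ p₂ N) k ≤ c₂ := by
  have hp₂ : p₂ ≠ ∞ := ne_top_of_le_ne_top (by simp) h₂
  refine ⟨1 / 2, 1, by norm_num, by norm_num, fun N k hk hN =>
    ⟨le_kolmogorovNumber _ hk fun L hL => ?_, kolmogorovNumber_le_of_norm_le _ (fun x hx =>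
      (PiLp.norm_toLp_le_of_exponent_le h₁ hp₂ x.ofLp).trans hx) hk⟩⟩
  let e : PiLp p₂ (fun _ : Fin N => ℂ) ≃ₗ[ℂ] EuclideanSpace ℂ (Fin N) :=
    (WithLp.linearEquiv p₂ ℂ (Fin N → ℂ)).trans (WithLp.linearEquiv 2 ℂ (Fin N → ℂ)).symm
  have hrank : Module.finrank ℂ (L.map e.toLinearMap) < k := by
    rw [LinearEquiv.finrank_map_eq]
    rw [← Module.finrank_eq_rank] at hL
    exact_mod_cast hL
  obtain ⟨i, hi⟩ := (EuclideanSpace.basisFun (Fin N) ℂ).exists_half_le_norm_sub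
    (L.map e.toLinearMap) (by rw [Fintype.card_fin]; omega)
  refine ⟨WithLp.toLp p₁ (Pi.single i 1), by simp, fun z hz => ?_⟩
  refine (hi (e z) (Submodule.mem_map_of_mem hz)).trans ?_
  rw [EuclideanSpace.basisFun_apply]
  exact PiLp.norm_toLp_le_of_exponent_le h₂ (by simp) (Pi.single i 1 - z.ofLp)
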